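/- arXiv:1812.05859 — 3 statements merged into one kernel-verified Lean document; each statement's English description precedes it below -/
import Mathlib

section
/- Let σ : ℝ → ℝ be differentiable with σ(x) > 0 for all x, let μ : ℝ → ℝ, let ν ∈ ℝ be a constant, fix x₀ ∈ ℝ and h₀ ∈ ℝ, and define h(x) := h₀ · exp(ν · ∫_{x₀}^{x} (1/σ(y)) dy). Assume σ is continuous (so the integral is well defined) and σ' is the derivative of σ. Then for every x ∈ ℝ: (i) σ(x)·h'(x) = ν·h(x), and (ii) (1/2)·σ(x)²·h''(x) + μ(x)·h'(x) = f(x)·h(x), where f(x) := ν·(μ(x) + (1/2)·σ(x)·(ν − σ'(x))) / σ(x). -/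
open intervalIntegral

/-- In the scalar consistency analysis with constant market-model volatility `ν`, the
function `h(x) = h₀ exp(ν ∫_{x₀}^x dy/σ(y))` satisfies the diffusion consistency equation
`σ h' = ν h` and the drift consistency equation `L h = f h` with roll yield
`f(x) = ν (μ(x) + (1/2)σ(x)(ν − σ'(x)))/σ(x)`. -/
theorem scalar_consistency_constant_vol
    (σ μ : ℝ → ℝ) (ν x₀ h₀ : ℝ)
    (hσpos : ∀ x, 0 < σ x) (hσcont : Continuous σ) (hσdiff : Differentiable ℝ σ)
    (h : ℝ → ℝ)
    (hdef : ∀ x, h x = h₀ * Real.exp (ν * ∫ y in x₀..x, 1 / σ y)) :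
    ∀ x, σ x * deriv h x = ν * h x ∧
      (1/2) * σ x ^ 2 * deriv (deriv h) x + μ x * deriv h x
        = (ν * (μ x + (1/2) * σ x * (ν - deriv σ x)) / σ x) * h x := by
  have hσne : ∀ x, σ x ≠ 0 := fun x => (hσpos x).ne'
  have hcont : Continuous fun y => 1 / σ y := continuous_const.div hσcont hσne
  have hderiv : ∀ x, HasDerivAt h (ν * h x / σ x) x := by
    intro x
    have hint : HasDerivAt (fun x => ∫ y in x₀..x, 1 / σ y) (1 / σ x) x :=
      hcont.integral_hasStrictDerivAt x₀ x |>.hasDerivAt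
    rw [funext hdef]
    refine ((hint.const_mul ν).exp.const_mul h₀).congr_deriv ?_
    ring
  have hderiv_eq : deriv h = fun x => ν * h x / σ x := funext fun x => (hderiv x).deriv
  intro x
  have hderiv2 : deriv (deriv h) x =
      (ν * (ν * h x / σ x) * σ x - ν * h x * deriv σ x) / σ x ^ 2 := by
    rw [hderiv_eq]
    exact (((hderiv x).const_mul ν).div (hσdiff x).hasDerivAt (hσne x)).deriv
  have hx := hσne x
  rw [hderiv2, (hderiv x).deriv]
  constructor
  · field_simp
  · field_simp
    ring
end

section
/- Let κ₁, κ₂, τ > 0 with κ₁ ≠ κ₂. Then I := ∫₀^τ (e^{−κ₂ t} − e^{−κ₁ t})/(κ₁ − κ₂) dt > 0; consequently, setting b₁ := κ₁ τ / (1 − e^{−κ₁ τ}) and b₂ := −b₁ · (κ₂ τ / (1 − e^{−κ₂ τ})) · (κ₁/τ) · I, one has b₁ > 0 and b₂ < 0. -/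
open intervalIntegral

theorem exp_sub_exp_div_pos {a b t : ℝ} (ht : 0 < t) (hab : a ≠ b) :
    0 < (Real.exp (-b * t) - Real.exp (-a * t)) / (a - b) := by
  rcases lt_or_gt_of_ne hab with h | h
  · refine div_pos_of_neg_of_neg (sub_neg.2 (Real.exp_lt_exp.2 ?_)) (sub_neg.2 h)
    nlinarith
  · refine div_pos (sub_pos.2 (Real.exp_lt_exp.2 ?_)) (sub_pos.2 h)
    nlinarith

theorem integral_exp_sub_exp_div_pos {a b τ : ℝ} (hτ : 0 < τ) (hab : a ≠ b) :
    0 < ∫ t in (0:ℝ)..τ, (Real.exp (-b * t) - Real.exp (-a * t)) / (a - b) := by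
  refine intervalIntegral_pos_of_pos_on (Continuous.intervalIntegrable ?_ _ _)
    (fun t ht => exp_sub_exp_div_pos ht.1 hab) hτ
  fun_prop

theorem mul_div_one_sub_exp_pos {a τ : ℝ} (ha : 0 < a) (hτ : 0 < τ) :
    0 < a * τ / (1 - Real.exp (-a * τ)) := by
  refine div_pos (mul_pos ha hτ) (sub_pos.2 (Real.exp_lt_one_iff.2 ?_))
  nlinarith [mul_pos ha hτ]

/-- In the double Nelson simplified inverse problem, the integral
`I = ∫₀^τ (e^{−κ₂t} − e^{−κ₁t})/(κ₁ − κ₂) dt` is positive, the coefficient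
`b₁ = κ₁τ/(1 − e^{−κ₁τ})` is positive, and
`b₂ = −b₁ (κ₂τ/(1 − e^{−κ₂τ})) (κ₁/τ) I` is negative. -/
theorem double_nelson_b2_negative
    (κ₁ κ₂ τ : ℝ) (hκ₁ : 0 < κ₁) (hκ₂ : 0 < κ₂) (hτ : 0 < τ) (hne : κ₁ ≠ κ₂) :
    (0 < ∫ t in (0:ℝ)..τ, (Real.exp (-κ₂ * t) - Real.exp (-κ₁ * t)) / (κ₁ - κ₂)) ∧
    (0 < κ₁ * τ / (1 - Real.exp (-κ₁ * τ))) ∧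
    (-(κ₁ * τ / (1 - Real.exp (-κ₁ * τ))) * (κ₂ * τ / (1 - Real.exp (-κ₂ * τ)))
        * (κ₁ / τ)
        * (∫ t in (0:ℝ)..τ, (Real.exp (-κ₂ * t) - Real.exp (-κ₁ * t)) / (κ₁ - κ₂)) < 0) := by
  have hI := integral_exp_sub_exp_div_pos hτ hne
  have h₁ := mul_div_one_sub_exp_pos hκ₁ hτ
  have h₂ := mul_div_one_sub_exp_pos hκ₂ hτ
  refine ⟨hI, h₁, ?_⟩
  rw [neg_mul, neg_mul, neg_mul, neg_lt_zero]
  exact mul_pos (mul_pos (mul_pos h₁ h₂) (div_pos hκ₁ hτ)) hI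
end

section
/- Let κ₁, κ₂, τ > 0 with κ₁ ≠ κ₂ and x̄ ∈ ℝ. For x₁, x₂ ∈ ℝ define u₂(t) := e^{−κ₂ t} x₂ + (1 − e^{−κ₂ t}) x̄ and u₁(t) := e^{−κ₁ t} x₁ + (κ₁ (e^{−κ₂ t} − e^{−κ₁ t})/(κ₁ − κ₂)) x₂ + (1 − e^{−κ₁ t}) x̄ − (κ₁ (e^{−κ₂ t} − e^{−κ₁ t})/(κ₁ − κ₂)) x̄. Set A := (1 − e^{−κ₁ τ})/(κ₁ τ), B := (1/τ) ∫₀^τ κ₁ (e^{−κ₂ t} − e^{−κ₁ t})/(κ₁ − κ₂) dt, C := (1 − e^{−κ₂ τ})/(κ₂ τ), b₁ := 1/A, b₂ := −b₁ B / C, and c := −(b₁ (1 − A − B) + b₂ (1 − C)) · x̄. Then for all x₁, x₂ ∈ ℝ, (1/τ) ∫₀^τ (b₁ u₁(t) + b₂ u₂(t) + c) dt = x₁. -/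
open intervalIntegral

/-- The time average over `[0, τ]` of the exponential decay `t ↦ exp (-κ * t)`. -/
lemma average_exp_neg_mul {κ τ : ℝ} (hκ : κ ≠ 0) :
    (1 / τ) * ∫ t in (0:ℝ)..τ, Real.exp (-κ * t) = (1 - Real.exp (-κ * τ)) / (κ * τ) := by
  rw [integral_comp_mul_left _ (neg_ne_zero.mpr hκ), integral_exp, mul_zero, Real.exp_zero,
    smul_eq_mul, one_div, inv_neg, div_eq_mul_inv, mul_inv]
  ring

/-- The averaged exponential decay is positive. -/
lemma average_exp_neg_mul_pos {κ τ : ℝ} (hκ : 0 < κ) (hτ : 0 < τ) :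
    0 < (1 - Real.exp (-κ * τ)) / (κ * τ) := by
  have h : Real.exp (-κ * τ) < 1 := Real.exp_lt_one_iff.mpr (by nlinarith [mul_pos hκ hτ])
  exact div_pos (sub_pos.mpr h) (mul_pos hκ hτ)

/-- Time averaging is linear and fixes constants. -/
lemma average_linear_combination {f g h : ℝ → ℝ} (hf : Continuous f) (hg : Continuous g)
    (hh : Continuous h) {τ : ℝ} (hτ : τ ≠ 0) (p q r s : ℝ) :
    (1 / τ) * ∫ t in (0:ℝ)..τ, (p * f t + q * g t + r * h t + s) =
      p * ((1 / τ) * ∫ t in (0:ℝ)..τ, f t) + q * ((1 / τ) * ∫ t in (0:ℝ)..τ, g t)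
        + r * ((1 / τ) * ∫ t in (0:ℝ)..τ, h t) + s := by
  have hp : IntervalIntegrable (fun t => p * f t) MeasureTheory.volume 0 τ :=
    (hf.const_mul p).intervalIntegrable _ _
  have hq : IntervalIntegrable (fun t => q * g t) MeasureTheory.volume 0 τ :=
    (hg.const_mul q).intervalIntegrable _ _
  have hr : IntervalIntegrable (fun t => r * h t) MeasureTheory.volume 0 τ :=
    (hh.const_mul r).intervalIntegrable _ _
  rw [integral_add ((hp.add hq).add hr) intervalIntegrable_const,
    integral_add (hp.add hq) hr, integral_add hp hq]
  simp only [integral_const_mul, integral_const, smul_eq_mul]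
  field_simp
  ring

/-- Explicit solution of the simplified double Nelson inverse problem: with the linear
ansatz `v²(x) = b₁x₁ + b₂x₂ + c` and the explicit conditional means `u₁, u₂`, time
averaging over `[0, τ]` recovers `x₁`. -/
theorem double_nelson_simplified_inverse_problem
    (κ₁ κ₂ τ : ℝ) (hκ₁ : 0 < κ₁) (hκ₂ : 0 < κ₂) (hτ : 0 < τ) (hne : κ₁ ≠ κ₂)
    (xbar : ℝ) (A B C b₁ b₂ c : ℝ)
    (hA : A = (1 - Real.exp (-κ₁ * τ)) / (κ₁ * τ))
    (hB : B = (1/τ) * ∫ t in (0:ℝ)..τ,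
        κ₁ * (Real.exp (-κ₂ * t) - Real.exp (-κ₁ * t)) / (κ₁ - κ₂))
    (hC : C = (1 - Real.exp (-κ₂ * τ)) / (κ₂ * τ))
    (hb₁ : b₁ = 1 / A) (hb₂ : b₂ = -b₁ * B / C)
    (hc : c = -(b₁ * (1 - A - B) + b₂ * (1 - C)) * xbar) :
    ∀ x₁ x₂ : ℝ,
      (1/τ) * ∫ t in (0:ℝ)..τ,
          (b₁ * (Real.exp (-κ₁ * t) * x₁
              + (κ₁ * (Real.exp (-κ₂ * t) - Real.exp (-κ₁ * t)) / (κ₁ - κ₂)) * x₂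
              + (1 - Real.exp (-κ₁ * t)) * xbar
              - (κ₁ * (Real.exp (-κ₂ * t) - Real.exp (-κ₁ * t)) / (κ₁ - κ₂)) * xbar)
            + b₂ * (Real.exp (-κ₂ * t) * x₂ + (1 - Real.exp (-κ₂ * t)) * xbar)
            + c)
        = x₁ := by
  intro x₁ x₂
  have hA₀ : A ≠ 0 := hA ▸ (average_exp_neg_mul_pos hκ₁ hτ).ne'
  have hC₀ : C ≠ 0 := hC ▸ (average_exp_neg_mul_pos hκ₂ hτ).ne'
  have havg := average_linear_combination
    (f := fun t => Real.exp (-κ₁ * t))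
    (g := fun t => κ₁ * (Real.exp (-κ₂ * t) - Real.exp (-κ₁ * t)) / (κ₁ - κ₂))
    (h := fun t => Real.exp (-κ₂ * t))
    (by fun_prop) (by fun_prop) (by fun_prop) hτ.ne'
    (b₁ * (x₁ - xbar)) (b₁ * (x₂ - xbar)) (b₂ * (x₂ - xbar)) (b₁ * xbar + b₂ * xbar + c)
  rw [average_exp_neg_mul hκ₁.ne', average_exp_neg_mul hκ₂.ne', ← hA, ← hB, ← hC] at havg
  have hA₁ : b₁ * A = 1 := by rw [hb₁, one_div_mul_cancel hA₀]
  have hC₁ : b₂ * C = -b₁ * B := by rw [hb₂, div_mul_cancel₀ _ hC₀]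
  calc
    _ = _ := by
      congr 1
      refine integral_congr fun t _ => ?_
      ring
    _ = _ := havg
    _ = x₁ := by
      rw [hc]
      linear_combination x₁ * hA₁ + x₂ * hC₁
end
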